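/- arXiv:2502.05804 — 2 statements merged into one kernel-verified Lean document; each statement's English description precedes it below -/
import Mathlib

section
/- Let q ≠ 0, K a convex body with 0 in its interior, and f : S^{n-1} → ℝ continuous. For small t define h_t(v) = (h_K(v)^q + t f(v)^q)^{1/q} (assuming f > 0, or |t| small enough that h_t is well-defined and positive). Then for almost every v ∈ S^{n-1}, the radial function of the Wulff shape [h_t] satisfies lim_{t→0} (ρ_{[h_t]}(v) − ρ_K(v))/t = (f(g_K(r_K(v)))^q / (q h_K(g_K(r_K(v)))^q)) ρ_K(v), and moreover there is M > 0 with |ρ_{[h_t]}(v) − ρ_K(v)| ≤ M|t| for all v ∈ S^{n-1} and all small t. -/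
open scoped RealInnerProductSpace
open MeasureTheory Filter Topology

noncomputable def suppFn {n : ℕ} (K : Set (EuclideanSpace ℝ (Fin n)))
    (v : EuclideanSpace ℝ (Fin n)) : ℝ :=
  sSup ((fun x => ⟪x, v⟫) '' K)

noncomputable def radFn {n : ℕ} (K : Set (EuclideanSpace ℝ (Fin n)))
    (u : EuclideanSpace ℝ (Fin n)) : ℝ :=
  sSup {c : ℝ | 0 ≤ c ∧ c • u ∈ K}

def wulff {n : ℕ} (f : EuclideanSpace ℝ (Fin n) → ℝ) : Set (EuclideanSpace ℝ (Fin n)) :=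
  {x | ∀ u : EuclideanSpace ℝ (Fin n), ‖u‖ = 1 → ⟪x, u⟫ ≤ f u}


lemma aux_unif {X : Type*} [TopologicalSpace X] [CompactSpace X] (P : X → ℝ → Prop)
    (h : ∀ x, ∀ᶠ z : X × ℝ in 𝓝 (x, 0), P z.1 z.2) :
    ∀ᶠ t : ℝ in 𝓝 0, ∀ x, P x t := by
  have := isCompact_univ.eventually_forall_of_forall_eventually (x₀ := (0:ℝ))
    (P := fun (t : ℝ) (x : X) => P x t) (K := Set.univ) (fun x _ => by
      have := (continuous_swap (X := ℝ) (Y := X)).tendsto (0, x) |>.eventually (h x)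
      exact this)
  filter_upwards [this] with t ht x using ht x trivial

lemma aux_pow {X : Type*} [TopologicalSpace X] [CompactSpace X] (A B : X → ℝ)
    (hA : Continuous A) (hB : Continuous B) (hA0 : ∀ x, 0 < A x) (p ε : ℝ) (hε : 0 < ε) :
    ∃ δ > 0, ∀ t : ℝ, |t| < δ → ∀ x, 0 < A x + t * B x ∧
      |(A x + t * B x) ^ p - A x ^ p - t * (p * B x * A x ^ (p - 1))| ≤ ε * |t| := by
  have hlin : Continuous fun z : X × ℝ => A z.1 + z.2 * B z.1 := by fun_prop
  have h1 : ∀ᶠ t : ℝ in 𝓝 0, ∀ x, 0 < A x + t * B x := by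
    apply aux_unif (fun x t => 0 < A x + t * B x)
    intro x
    exact hlin.continuousAt.eventually_const_lt (by simpa using hA0 x)
  have h2 : ∀ᶠ t : ℝ in 𝓝 0, ∀ x,
      |p * B x * (A x + t * B x) ^ (p - 1) - p * B x * A x ^ (p - 1)| < ε := by
    apply aux_unif (fun x t =>
      |p * B x * (A x + t * B x) ^ (p - 1) - p * B x * A x ^ (p - 1)| < ε)
    intro x
    have hc1 : ContinuousAt (fun z : X × ℝ => (A z.1 + z.2 * B z.1) ^ (p - 1)) (x, 0) :=
      hlin.continuousAt.rpow_const (Or.inl (by simpa using (hA0 x).ne'))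
    have hc2 : ContinuousAt (fun z : X × ℝ => (A z.1) ^ (p - 1)) (x, 0) :=
      (hA.comp continuous_fst).continuousAt.rpow_const (Or.inl (by simpa using (hA0 x).ne'))
    have hc3 : ContinuousAt (fun z : X × ℝ => p * B z.1) (x, 0) := by fun_prop
    have hc := ((hc3.mul hc1).sub (hc3.mul hc2)).abs
    exact hc.eventually_lt_const (by simpa using hε)
  obtain ⟨δ, hδ, H⟩ := Metric.eventually_nhds_iff.1 (h1.and h2)
  refine ⟨δ, hδ, fun t ht x => ⟨(H (by simpa using ht)).1 x, ?_⟩⟩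
  have key := (convex_ball (0:ℝ) δ).norm_image_sub_le_of_norm_hasDerivWithin_le
    (f := fun s => (A x + s * B x) ^ p - s * (p * B x * A x ^ (p - 1)))
    (f' := fun s => p * B x * (A x + s * B x) ^ (p - 1) - p * B x * A x ^ (p - 1))
    (C := ε) (x := 0) (y := t) ?_ ?_ (by simpa using hδ) (by simpa using ht)
  · simp only [Real.norm_eq_abs, zero_mul, add_zero, sub_zero] at key
    convert key using 2
    ring
  · intro s hs
    have hpos := (H (Metric.mem_ball.1 hs)).1 x
    have d1 : HasDerivAt (fun s : ℝ => A x + s * B x) (B x) s := by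
      simpa using ((hasDerivAt_id s).mul_const (B x)).const_add (A x)
    have d2 := d1.rpow_const (p := p) (Or.inl hpos.ne')
    have d3 := (hasDerivAt_id s).mul_const (p * B x * A x ^ (p - 1))
    have d4 := (d2.sub d3).hasDerivWithinAt (s := Metric.ball 0 δ)
    have e : p * B x * (A x + s * B x) ^ (p - 1) - p * B x * A x ^ (p - 1) =
        B x * p * (A x + s * B x) ^ (p - 1) - 1 * (p * B x * A x ^ (p - 1)) := by ring
    simp only [e]
    exact d4
  · intro s hs
    exact ((H (Metric.mem_ball.1 hs)).2 x).le

lemma aux_danskin {X : Type*} [TopologicalSpace X] [CompactSpace X]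
    (b : ℝ → X → ℝ) (c : X → ℝ) (F : ℝ → ℝ) (δ C : ℝ) (hδ : 0 < δ)
    (hb0 : Continuous (b 0)) (hc : Continuous c)
    (hC : ∀ t, |t| < δ → ∀ x, |b t x - b 0 x| ≤ C * |t|)
    (hd : ∀ ε > 0, ∃ δ' > 0, ∀ t, |t| < δ' → ∀ x, |b t x - b 0 x - t * c x| ≤ ε * |t|)
    (hle : ∀ t, |t| < δ → ∀ x, b t x ≤ F t)
    (hex : ∀ t, |t| < δ → ∃ x, b t x = F t)
    (x0 : X) (hx0 : b 0 x0 = F 0) (huniq : ∀ x, b 0 x = F 0 → x = x0) :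
    HasDerivAt F (c x0) 0 := by
  have h00 : |(0:ℝ)| < δ := by simpa using hδ
  rw [hasDerivAt_iff_isLittleO, Asymptotics.isLittleO_iff]
  intro ε hε
  obtain ⟨δ', hδ', hd⟩ := hd (ε / 2) (by positivity)
  -- neighbourhood of x0
  have hU : IsCompact {x | ε / 2 ≤ |c x - c x0|} :=
    (isClosed_le continuous_const (by fun_prop)).isCompact
  have : ∃ η > 0, ∀ x, ε / 2 ≤ |c x - c x0| → b 0 x ≤ F 0 - η := by
    rcases Set.eq_empty_or_nonempty {x | ε / 2 ≤ |c x - c x0|} with h | h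
    · refine ⟨1, one_pos, fun x hx => ?_⟩
      have : x ∈ {x | ε / 2 ≤ |c x - c x0|} := hx
      rw [h] at this; exact this.elim
    · obtain ⟨y, hy, hmax⟩ := hU.exists_isMaxOn h hb0.continuousOn
      refine ⟨F 0 - b 0 y, ?_, fun x hx => by linarith [show b 0 x ≤ b 0 y from hmax hx]⟩
      have h1 := hle 0 h00 y
      rcases h1.lt_or_eq with h2 | h2
      · linarith
      · have := huniq y h2
        simp only [Set.mem_ofPred_eq, this, sub_self, abs_zero] at hy
        linarith
  obtain ⟨η, hη, hfar⟩ := this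
  have e1 : ∀ᶠ t : ℝ in 𝓝 0, 2 * C * |t| < η := by
    have : Continuous fun t : ℝ => 2 * C * |t| := by fun_prop
    exact this.continuousAt.eventually_lt_const (by simpa using hη)
  have e2 : ∀ᶠ t : ℝ in 𝓝 0, |t| < δ :=
    (continuous_abs).continuousAt.eventually_lt_const (by simpa using hδ)
  have e3 : ∀ᶠ t : ℝ in 𝓝 0, |t| < δ' :=
    (continuous_abs).continuousAt.eventually_lt_const (by simpa using hδ')
  filter_upwards [e1, e2, e3] with t h1 h2 h3
  obtain ⟨x, hx⟩ := hex t h2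
  simp only [sub_zero, smul_eq_mul, Real.norm_eq_abs]
  have l1 := hle t h2 x0
  have l2 := hle 0 h00 x
  have k1 := abs_le.1 (hd t h3 x)
  have k2 := abs_le.1 (hd t h3 x0)
  have m1 := abs_le.1 (hC t h2 x)
  have m2 := abs_le.1 (hC t h2 x0)
  have near : |c x - c x0| < ε / 2 := by
    by_contra hcon
    have := hfar x (not_lt.1 hcon)
    linarith
  have near2 : |t * (c x - c x0)| ≤ ε / 2 * |t| := by
    rw [abs_mul, mul_comm]
    exact mul_le_mul_of_nonneg_right near.le (abs_nonneg _)
  have n3 := abs_le.1 near2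
  rw [abs_le]
  constructor <;> nlinarith


lemma aux_supp_cont {n : ℕ} {K : Set (EuclideanSpace ℝ (Fin n))} (hK : IsCompact K) :
    Continuous (suppFn K) :=
  hK.continuous_sSup (f := fun v x : EuclideanSpace ℝ (Fin n) => ⟪x, v⟫)
    (by simp only [Function.HasUncurry.uncurry, id]; fun_prop)

lemma aux_supp_le {n : ℕ} {K : Set (EuclideanSpace ℝ (Fin n))} (hK : IsCompact K)
    {y : EuclideanSpace ℝ (Fin n)} (hy : y ∈ K) (u) : ⟪y, u⟫ ≤ suppFn K u :=
  le_csSup (hK.image (by fun_prop)).bddAbove ⟨y, hy, rfl⟩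

lemma aux_supp_pos {n : ℕ} {K : Set (EuclideanSpace ℝ (Fin n))} (hK : IsCompact K)
    (h0K : (0 : EuclideanSpace ℝ (Fin n)) ∈ interior K) (u : EuclideanSpace ℝ (Fin n))
    (hu : ‖u‖ = 1) : 0 < suppFn K u := by
  obtain ⟨r, hr, hball⟩ := Metric.mem_nhds_iff.1 (mem_interior_iff_mem_nhds.1 h0K)
  have hm : (r / 2) • u ∈ K := hball (by
    simp only [Metric.mem_ball, dist_zero_right, norm_smul, hu, Real.norm_eq_abs]
    rw [abs_of_pos (by positivity)]; linarith)
  have := aux_supp_le hK hm u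
  rw [real_inner_smul_left, real_inner_self_eq_norm_sq, hu] at this
  linarith

lemma aux_wulff {n : ℕ} {K : Set (EuclideanSpace ℝ (Fin n))} (hconv : Convex ℝ K) (hK : IsCompact K)
    (h0 : (0 : EuclideanSpace ℝ (Fin n)) ∈ K) : wulff (suppFn K) = K := by
  ext x
  refine ⟨fun hx => ?_, fun hx u _ => aux_supp_le hK hx u⟩
  by_contra hxK
  obtain ⟨φ, s, h1, h2⟩ := geometric_hahn_banach_closed_point hconv hK.isClosed hxK
  set w := (InnerProductSpace.toDual ℝ (EuclideanSpace ℝ (Fin n))).symm φ with hw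
  have hφ : ∀ y, φ y = ⟪y, w⟫ := fun y => by
    rw [real_inner_comm, hw, InnerProductSpace.toDual_symm_apply]
  have hw0 : w ≠ 0 := by
    intro h
    have a := h1 0 h0
    rw [hφ, h, inner_zero_right] at a
    rw [hφ, h, inner_zero_right] at h2
    linarith
  have hwn : 0 < ‖w‖ := norm_pos_iff.2 hw0
  have := hx (‖w‖⁻¹ • w) (by rw [norm_smul, norm_inv, norm_norm, inv_mul_cancel₀ hwn.ne'])
  have h3 : suppFn K (‖w‖⁻¹ • w) ≤ ‖w‖⁻¹ * s := by
    refine csSup_le (Set.Nonempty.image _ ⟨0, h0⟩) ?_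
    rintro _ ⟨y, hy, rfl⟩
    simp only [real_inner_smul_right]
    rw [← hφ]
    exact mul_le_mul_of_nonneg_left (h1 y hy).le (by positivity)
  rw [real_inner_smul_right, ← hφ] at this
  have := lt_of_lt_of_le (mul_lt_mul_of_pos_left h2 (inv_pos.2 hwn)) (this.trans h3)
  exact lt_irrefl _ this

lemma aux_rad {n : ℕ} (h : EuclideanSpace ℝ (Fin n) → ℝ) (hpos : ∀ u, ‖u‖ = 1 → 0 < h u)
    (v : EuclideanSpace ℝ (Fin n)) (F : ℝ) (hF : 0 < F)
    (hle : ∀ u, ‖u‖ = 1 → ⟪v, u⟫ * (h u)⁻¹ ≤ F) (hex : ∃ u, ‖u‖ = 1 ∧ ⟪v, u⟫ * (h u)⁻¹ = F) :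
    radFn (wulff h) v = F⁻¹ := by
  have : {c : ℝ | 0 ≤ c ∧ c • v ∈ wulff h} = Set.Icc 0 F⁻¹ := by
    ext c
    simp only [Set.mem_ofPred_eq, Set.mem_Icc, wulff, real_inner_smul_left]
    refine and_congr_right fun hc => ⟨fun H => ?_, fun H u hu => ?_⟩
    · obtain ⟨u, hu, rfl⟩ := hex
      have := H u hu
      rw [← one_div, le_div_iff₀ hF, ← mul_assoc, ← div_eq_mul_inv, div_le_one (hpos u hu)]
      exact this
    · rw [← one_div, le_div_iff₀ hF] at H
      have h1 := mul_le_mul_of_nonneg_left (hle u hu) hc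
      have h2 := h1.trans H
      rwa [← mul_assoc, ← div_eq_mul_inv, div_le_one (hpos u hu)] at h2
  rw [radFn, this, csSup_Icc (by positivity)]

lemma aux_ae {n : ℕ} {K : Set (EuclideanSpace ℝ (Fin n))} (hconv : Convex ℝ K)
    (h0K : (0 : EuclideanSpace ℝ (Fin n)) ∈ interior K) :
    ∀ᵐ v : Metric.sphere (0 : EuclideanSpace ℝ (Fin n)) 1
          ∂((volume : Measure (EuclideanSpace ℝ (Fin n))).toSphere),
      DifferentiableAt ℝ (gauge K) (v : EuclideanSpace ℝ (Fin n)) := by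
  obtain ⟨C, hC⟩ := hconv.lipschitz_gauge (mem_interior_iff_mem_nhds.1 h0K)
  have hae := hC.ae_differentiableAt (μ := (volume : Measure (EuclideanSpace ℝ (Fin n))))
  have hm : MeasurableSet {v : Metric.sphere (0 : EuclideanSpace ℝ (Fin n)) 1 |
      ¬ DifferentiableAt ℝ (gauge K) (v : EuclideanSpace ℝ (Fin n))} :=
    ((measurableSet_of_differentiableAt ℝ (gauge K)).preimage measurable_subtype_coe).compl
  rw [ae_iff] at hae ⊢
  rw [Measure.toSphere_apply' _ hm]
  convert mul_zero _
  refine measure_mono_null ?_ hae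
  rintro _ ⟨c, hc, _, ⟨v, hv, rfl⟩, rfl⟩ hd
  apply hv
  have h1 : DifferentiableAt ℝ (fun x : EuclideanSpace ℝ (Fin n) => gauge K (c • x)) v :=
    DifferentiableAt.comp (g := gauge K) (f := fun x : EuclideanSpace ℝ (Fin n) => c • x) v hd (by fun_prop)
  have h2 : gauge K = fun x : EuclideanSpace ℝ (Fin n) => c⁻¹ * gauge K (c • x) := by
    ext x
    rw [gauge_smul_of_nonneg hc.1.le, smul_eq_mul, inv_mul_cancel_left₀ hc.1.ne']
  rw [h2]
  exact h1.const_mul _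

lemma aux_grad {n : ℕ} {K : Set (EuclideanSpace ℝ (Fin n))} (hK : IsCompact K)
    (h0K : (0 : EuclideanSpace ℝ (Fin n)) ∈ interior K) (v : EuclideanSpace ℝ (Fin n)) (ρ : ℝ)
    (hρ : 0 < ρ) (hv : ρ • v ∈ K) (hd : DifferentiableAt ℝ (gauge K) v)
    (u : EuclideanSpace ℝ (Fin n)) (hu : ‖u‖ = 1) (h : ⟪v, u⟫ * (suppFn K u)⁻¹ = ρ⁻¹) :
    fderiv ℝ (gauge K) v = innerSL ℝ ((suppFn K u)⁻¹ • u) := by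
  have hp := aux_supp_pos hK h0K u hu
  have hge : ∀ y, ⟪y, u⟫ * (suppFn K u)⁻¹ ≤ gauge K y := by
    intro y
    rw [gauge_def]
    refine le_csInf ?_ ?_
    · have := (absorbent_nhds_zero (𝕜 := ℝ) (mem_interior_iff_mem_nhds.1 h0K)).gauge_set_nonempty (x := y)
      exact this
    · rintro c ⟨hc, z, hz, rfl⟩
      have := aux_supp_le hK hz u
      have hc : 0 < c := hc
      simp only [real_inner_smul_left]
      rw [← div_eq_mul_inv, div_le_iff₀ hp]
      exact mul_le_mul_of_nonneg_left this hc.le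
  have hle : gauge K v ≤ ρ⁻¹ := gauge_le_of_mem (by positivity)
    ⟨ρ • v, hv, by simp [smul_smul, inv_mul_cancel₀ hρ.ne']⟩
  have hmin : IsLocalMin (fun y => gauge K y - innerSL ℝ ((suppFn K u)⁻¹ • u) y) v := by
    refine Filter.Eventually.of_forall fun y => ?_
    have e : ∀ y, innerSL ℝ ((suppFn K u)⁻¹ • u) y = ⟪y, u⟫ * (suppFn K u)⁻¹ := by
      intro y
      rw [innerSL_apply_apply, real_inner_smul_left, real_inner_comm, mul_comm]
    simp only [e]
    have := hge y
    linarith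
  have := hmin.hasFDerivAt_eq_zero
    (hd.hasFDerivAt.sub (innerSL ℝ ((suppFn K u)⁻¹ • u)).hasFDerivAt)
  exact sub_eq_zero.1 this

lemma aux_uniq {n : ℕ} {K : Set (EuclideanSpace ℝ (Fin n))} (hK : IsCompact K)
    (h0K : (0 : EuclideanSpace ℝ (Fin n)) ∈ interior K) (v : EuclideanSpace ℝ (Fin n)) (ρ : ℝ)
    (hρ : 0 < ρ) (hv : ρ • v ∈ K) (hd : DifferentiableAt ℝ (gauge K) v)
    (u u' : EuclideanSpace ℝ (Fin n)) (hu : ‖u‖ = 1) (h : ⟪v, u⟫ * (suppFn K u)⁻¹ = ρ⁻¹)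
    (hu' : ‖u'‖ = 1) (h' : ⟪v, u'⟫ * (suppFn K u')⁻¹ = ρ⁻¹) : u = u' := by
  have e := (aux_grad hK h0K v ρ hρ hv hd u hu h).symm.trans
    (aux_grad hK h0K v ρ hρ hv hd u' hu' h')
  have e2 : (suppFn K u)⁻¹ • u = (suppFn K u')⁻¹ • u' := by
    refine ext_inner_right ℝ fun y => ?_
    simpa only [innerSL_apply_apply] using congrArg (fun L => L y) e
  have p1 := inv_pos.2 (aux_supp_pos hK h0K u hu)
  have p2 := inv_pos.2 (aux_supp_pos hK h0K u' hu')
  have e3 := congrArg norm e2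
  rw [norm_smul, norm_smul, hu, hu', mul_one, mul_one, Real.norm_of_nonneg p1.le,
    Real.norm_of_nonneg p2.le] at e3
  rw [e3] at e2
  exact smul_right_injective _ p2.ne' e2

lemma aux_radmem {n : ℕ} {K : Set (EuclideanSpace ℝ (Fin n))} (hK : IsCompact K)
    (h0K : (0 : EuclideanSpace ℝ (Fin n)) ∈ interior K) (v : EuclideanSpace ℝ (Fin n))
    (hv : ‖v‖ = 1) : radFn K v • v ∈ frontier K := by
  have hbdd : BddAbove {c : ℝ | 0 ≤ c ∧ c • v ∈ K} := by
    obtain ⟨R, hR⟩ := hK.isBounded.exists_norm_le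
    refine ⟨R, fun c hc => ?_⟩
    have := hR _ hc.2
    rw [norm_smul, hv, mul_one, Real.norm_of_nonneg hc.1] at this
    exact this
  have hcl : IsClosed {c : ℝ | 0 ≤ c ∧ c • v ∈ K} :=
    isClosed_Ici.inter (hK.isClosed.preimage (f := fun c : ℝ => c • v) (by fun_prop))
  have hmem : 0 ≤ radFn K v ∧ radFn K v • v ∈ K :=
    hcl.csSup_mem ⟨0, le_rfl, by simpa using interior_subset h0K⟩ hbdd
  refine ⟨subset_closure hmem.2, fun hint => ?_⟩
  have hev : ∀ᶠ c : ℝ in 𝓝 (radFn K v), c • v ∈ interior K :=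
    (show Continuous fun c : ℝ => c • v by fun_prop).continuousAt.eventually
      (isOpen_interior.mem_nhds hint)
  obtain ⟨ε, hε, H⟩ := Metric.eventually_nhds_iff.1 hev
  have h1 := H (y := radFn K v + ε / 2) (by
    rw [Real.dist_eq]; simp only [add_sub_cancel_left]; rw [abs_of_pos (by positivity)]; linarith)
  have h2 : radFn K v + ε / 2 ≤ radFn K v :=
    le_csSup hbdd ⟨by linarith [hmem.1], interior_subset h1⟩
  linarith

set_option maxHeartbeats 2000000 in
/-- Variational formula for the radial function of the Wulff shape of
`h_t = (h_K^q + t f^q)^{1/q}`: a uniform Lipschitz-in-`t` bound, and for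
(spherical-Lebesgue) almost every unit vector `v`,
`(ρ_{[h_t]}(v) − ρ_K(v))/t → (f(g_K(r_K(v)))^q / (q h_K(g_K(r_K(v)))^q)) ρ_K(v)`. -/
theorem stmt10 {n : ℕ} (hn : 2 ≤ n) (q : ℝ) (hq : q ≠ 0)
    (K : Set (EuclideanSpace ℝ (Fin n)))
    (hKconv : Convex ℝ K) (hKcomp : IsCompact K)
    (h0K : (0 : EuclideanSpace ℝ (Fin n)) ∈ interior K)
    (f : EuclideanSpace ℝ (Fin n) → ℝ) (hf : Continuous f)
    (hfpos : ∀ v : EuclideanSpace ℝ (Fin n), ‖v‖ = 1 → 0 < f v)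
    -- the Gauss map of `K`: an outer unit normal at every boundary point
    (g : EuclideanSpace ℝ (Fin n) → EuclideanSpace ℝ (Fin n))
    (hg : ∀ x ∈ frontier K, ‖g x‖ = 1 ∧ ∀ y ∈ K, ⟪y, g x⟫ ≤ ⟪x, g x⟫) :
    ∃ δ > (0 : ℝ), ∃ M > (0 : ℝ),
      (∀ v : EuclideanSpace ℝ (Fin n), ‖v‖ = 1 → ∀ t : ℝ, |t| < δ →
        |radFn (wulff fun u => (suppFn K u ^ q + t * f u ^ q) ^ (1 / q)) v - radFn K v|
          ≤ M * |t|) ∧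
      ∀ᵐ v : Metric.sphere (0 : EuclideanSpace ℝ (Fin n)) 1
          ∂((volume : Measure (EuclideanSpace ℝ (Fin n))).toSphere),
        Tendsto
          (fun t : ℝ =>
            (radFn (wulff fun u => (suppFn K u ^ q + t * f u ^ q) ^ (1 / q))
                (v : EuclideanSpace ℝ (Fin n)) -
              radFn K (v : EuclideanSpace ℝ (Fin n))) / t)
          (𝓝[≠] 0)
          (𝓝 (f (g (radFn K (v : EuclideanSpace ℝ (Fin n)) • (v : EuclideanSpace ℝ (Fin n)))) ^ q /
              (q * suppFn K
                  (g (radFn K (v : EuclideanSpace ℝ (Fin n)) • (v : EuclideanSpace ℝ (Fin n)))) ^ q) *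
              radFn K (v : EuclideanSpace ℝ (Fin n)))) := by
  classical
  have hK0 : (0 : EuclideanSpace ℝ (Fin n)) ∈ K := interior_subset h0K
  let X := Metric.sphere (0 : EuclideanSpace ℝ (Fin n)) 1
  have hX : ∀ x : X, ‖(x : EuclideanSpace ℝ (Fin n))‖ = 1 := fun x => mem_sphere_zero_iff_norm.1 x.2
  have hcp : CompactSpace X := isCompact_iff_compactSpace.1 (isCompact_sphere _ _)
  let A : X → ℝ := fun x => suppFn K x ^ q
  let B : X → ℝ := fun x => f x ^ q
  have hhpos : ∀ x : X, 0 < suppFn K x := fun x => aux_supp_pos hKcomp h0K x (hX x)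
  have hA : Continuous A := ((aux_supp_cont hKcomp).comp continuous_subtype_val).rpow_const
    (fun x => Or.inl (hhpos x).ne')
  have hB : Continuous B := (hf.comp continuous_subtype_val).rpow_const
    (fun x => Or.inl (hfpos x (hX x)).ne')
  have hA0 : ∀ x, 0 < A x := fun x => Real.rpow_pos_of_pos (hhpos x) _
  let p : ℝ := -(1 / q)
  have hA0p : ∀ x, A x ^ p = (suppFn K x)⁻¹ := fun x => by
    simp only [A, p]
    rw [← Real.rpow_mul (hhpos x).le, mul_neg, mul_one_div_cancel hq, Real.rpow_neg_one]
  let c : X → ℝ := fun x => p * B x * A x ^ (p - 1)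
  have hc : Continuous c := (continuous_const.mul hB).mul
    (hA.rpow_const fun x => Or.inl (hA0 x).ne')
  have hAp : Continuous fun x => A x ^ p := hA.rpow_const fun x => Or.inl (hA0 x).ne'
  obtain ⟨Cb, hCb⟩ := isCompact_univ.exists_bound_of_continuousOn hc.continuousOn
  obtain ⟨δ1, hδ1, H1⟩ := aux_pow A B hA hB hA0 p 1 one_pos
  let C : ℝ := |Cb| + 1
  have hC0 : 0 < C := by positivity
  have hLip : ∀ t : ℝ, |t| < δ1 → ∀ x, |(A x + t * B x) ^ p - A x ^ p| ≤ C * |t| := by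
    intro t ht x
    have h1 := abs_le.1 (H1 t ht x).2
    have h2 : |t * c x| ≤ |Cb| * |t| := by
      rw [abs_mul, mul_comm]
      exact mul_le_mul_of_nonneg_right ((hCb x trivial).trans (le_abs_self _)) (abs_nonneg _)
    have h3 := abs_le.1 h2
    simp only [c] at h3
    rw [abs_le]
    simp only [C]
    constructor <;> linarith
  obtain ⟨c0, hc0, hc0le⟩ : ∃ c0 > 0, ∀ x, 2 * c0 ≤ A x ^ p := by
    rcases isEmpty_or_nonempty X with hE | hE
    · exact ⟨1, one_pos, fun x => hE.elim x⟩
    · obtain ⟨y, -, hy⟩ := isCompact_univ.exists_isMinOn Set.univ_nonempty hAp.continuousOn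
      refine ⟨A y ^ p / 2, half_pos (Real.rpow_pos_of_pos (hA0 y) _), fun x => ?_⟩
      have : A y ^ p ≤ A x ^ p := hy (Set.mem_univ x)
      linarith
  let δ := min δ1 (c0 / C)
  have hδ : 0 < δ := lt_min hδ1 (by positivity)
  have h00 : |(0:ℝ)| < δ := by simpa using hδ
  have hlow : ∀ t : ℝ, |t| < δ → ∀ x, c0 ≤ (A x + t * B x) ^ p := by
    intro t ht x
    have h1 := abs_le.1 (hLip t (ht.trans_le (min_le_left _ _)) x)
    have h2 : |t| < c0 / C := ht.trans_le (min_le_right _ _)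
    rw [lt_div_iff₀ hC0] at h2
    have h3 := hc0le x
    linarith
  have hpos : ∀ t : ℝ, |t| < δ → ∀ x, 0 < A x + t * B x := fun t ht x =>
    (H1 t (ht.trans_le (min_le_left _ _)) x).1
  let b : X → ℝ → X → ℝ := fun v t x =>
    ⟪(v : EuclideanSpace ℝ (Fin n)), (x : EuclideanSpace ℝ (Fin n))⟫ * (A x + t * B x) ^ p
  have hbc : ∀ v t, |t| < δ → Continuous (b v t) := by
    intro v t ht
    have : Continuous fun x => (A x + t * B x) ^ p :=
      (hA.add (continuous_const.mul hB)).rpow_const fun x => Or.inl (hpos t ht x).ne'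
    exact (by fun_prop : Continuous fun x : X =>
      ⟪(v : EuclideanSpace ℝ (Fin n)), (x : EuclideanSpace ℝ (Fin n))⟫).mul this
  have hin : ∀ v x : X, |⟪(v : EuclideanSpace ℝ (Fin n)), (x : EuclideanSpace ℝ (Fin n))⟫| ≤ 1 := by
    intro v x
    have := abs_real_inner_le_norm (v : EuclideanSpace ℝ (Fin n)) (x : EuclideanSpace ℝ (Fin n))
    rwa [hX, hX, mul_one] at this
  have hFex : ∀ (v : X) (t : ℝ), ∃ F : ℝ, |t| < δ → (∀ x, b v t x ≤ F) ∧ ∃ x, b v t x = F := by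
    intro v t
    by_cases ht : |t| < δ
    · obtain ⟨y, -, hy⟩ := isCompact_univ.exists_isMaxOn ⟨v, Set.mem_univ v⟩
        (hbc v t ht).continuousOn
      exact ⟨b v t y, fun _ => ⟨fun x => hy (Set.mem_univ x), y, rfl⟩⟩
    · exact ⟨0, fun h => (ht h).elim⟩
  choose F hF using hFex
  have hFlow : ∀ v t, |t| < δ → c0 ≤ F v t := by
    intro v t ht
    have h1 := (hF v t ht).1 v
    simp only [b] at h1
    rw [real_inner_self_eq_norm_sq, hX, one_pow, one_mul] at h1
    exact (hlow t ht v).trans h1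
  have hFpos : ∀ v t, |t| < δ → 0 < F v t := fun v t ht => hc0.trans_le (hFlow v t ht)
  have hrad : ∀ (v : X) t, |t| < δ →
      radFn (wulff fun u => (suppFn K u ^ q + t * f u ^ q) ^ (1 / q)) v = (F v t)⁻¹ := by
    intro v t ht
    have hinv : ∀ x : X, ((suppFn K x ^ q + t * f x ^ q) ^ (1 / q))⁻¹ = (A x + t * B x) ^ p :=
      fun x => (Real.rpow_neg (hpos t ht x).le _).symm
    refine aux_rad (fun u => (suppFn K u ^ q + t * f u ^ q) ^ (1 / q)) (fun u hu => ?_) v _ (hFpos v t ht) (fun u hu => ?_) ?_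
    · exact Real.rpow_pos_of_pos (hpos t ht ⟨u, mem_sphere_zero_iff_norm.2 hu⟩) _
    · have := (hF v t ht).1 ⟨u, mem_sphere_zero_iff_norm.2 hu⟩
      simp only [b] at this
      rwa [← hinv] at this
    · obtain ⟨x, hx⟩ := (hF v t ht).2
      refine ⟨x, hX x, ?_⟩
      rw [← hx, hinv]
  have hb0 : ∀ v x : X, b v 0 x =
      ⟪(v : EuclideanSpace ℝ (Fin n)), (x : EuclideanSpace ℝ (Fin n))⟫ * (suppFn K x)⁻¹ := by
    intro v x
    simp only [b, zero_mul, add_zero]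
    rw [hA0p]
  have hrad0 : ∀ v : X, radFn K v = (F v 0)⁻¹ := by
    intro v
    conv_lhs => rw [← aux_wulff hKconv hKcomp hK0]
    refine aux_rad _ (fun u hu => aux_supp_pos hKcomp h0K u hu) v _ (hFpos v 0 h00)
      (fun u hu => ?_) ?_
    · have := (hF v 0 h00).1 ⟨u, mem_sphere_zero_iff_norm.2 hu⟩
      rwa [hb0] at this
    · obtain ⟨x, hx⟩ := (hF v 0 h00).2
      refine ⟨x, hX x, ?_⟩
      rw [← hx, hb0]
  have hbLip : ∀ v t, |t| < δ → ∀ x, |b v t x - b v 0 x| ≤ C * |t| := by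
    intro v t ht x
    simp only [b, zero_mul, add_zero]
    rw [← mul_sub, abs_mul]
    have h1 := hLip t (ht.trans_le (min_le_left _ _)) x
    calc _ ≤ 1 * |(A x + t * B x) ^ p - A x ^ p| :=
          mul_le_mul_of_nonneg_right (hin v x) (abs_nonneg _)
      _ ≤ _ := by rw [one_mul]; exact h1
  have hFLip : ∀ v t, |t| < δ → |F v t - F v 0| ≤ C * |t| := by
    intro v t ht
    obtain ⟨x, hx⟩ := (hF v t ht).2
    obtain ⟨y, hy⟩ := (hF v 0 h00).2
    have h1 := abs_le.1 (hbLip v t ht x)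
    have h2 := abs_le.1 (hbLip v t ht y)
    have h3 := (hF v t ht).1 y
    have h4 := (hF v 0 h00).1 x
    rw [abs_le]
    constructor <;> linarith
  refine ⟨δ, hδ, C / c0 ^ 2, by positivity, ?_, ?_⟩
  · intro v hv t ht
    have e1 := hrad ⟨v, mem_sphere_zero_iff_norm.2 hv⟩ t ht
    have e2 := hrad0 ⟨v, mem_sphere_zero_iff_norm.2 hv⟩
    simp only at e1 e2
    rw [e1, e2]
    generalize (⟨v, mem_sphere_zero_iff_norm.2 hv⟩ : X) = w
    have p1 := hFpos w t ht
    have p2 := hFpos w 0 h00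
    have l1 := hFlow w t ht
    have l2 := hFlow w 0 h00
    rw [inv_sub_inv p1.ne' p2.ne', abs_div, abs_of_pos (mul_pos p1 p2), abs_sub_comm,
      div_mul_eq_mul_div]
    refine div_le_div₀ (by positivity) (hFLip w t ht) (by positivity) ?_
    rw [sq]
    exact mul_le_mul l1 l2 hc0.le p1.le
  · filter_upwards [aux_ae hKconv h0K] with v hv
    have hfr := aux_radmem hKcomp h0K v (hX v)
    have hmem : radFn K v • (v : EuclideanSpace ℝ (Fin n)) ∈ K := hKcomp.isClosed.frontier_subset hfr
    obtain ⟨hg1, hg2⟩ := hg _ hfr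
    have hρ : 0 < radFn K v := by rw [hrad0]; exact inv_pos.2 (hFpos v 0 h00)
    generalize hgx : g (radFn K v • (v : EuclideanSpace ℝ (Fin n))) = gx at *
    let x0 : X := ⟨gx, mem_sphere_zero_iff_norm.2 hg1⟩
    have hF0 : (radFn K v)⁻¹ = F v 0 := by rw [hrad0, inv_inv]
    have hx0 : b v 0 x0 = F v 0 := by
      refine le_antisymm ((hF v 0 h00).1 x0) ?_
      have h1 : suppFn K gx ≤ radFn K v * ⟪(v : EuclideanSpace ℝ (Fin n)), gx⟫ := by
        refine csSup_le (Set.Nonempty.image _ ⟨0, hK0⟩) ?_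
        rintro _ ⟨y, hy, rfl⟩
        have := hg2 y hy
        rwa [real_inner_smul_left] at this
      rw [hb0, ← hF0, ← div_eq_mul_inv, le_div_iff₀ (hhpos x0), inv_mul_le_iff₀ hρ]
      exact h1
    have huniq : ∀ x, b v 0 x = F v 0 → x = x0 := by
      intro x hx
      apply Subtype.ext
      refine aux_uniq hKcomp h0K v (radFn K v) hρ hmem hv x x0 (hX x) ?_ (hX x0) ?_
      · rw [hF0, ← hx, hb0]
      · rw [hF0, ← hx0, hb0]
    have hD := aux_danskin (b v)
      (fun x => ⟪(v : EuclideanSpace ℝ (Fin n)), (x : EuclideanSpace ℝ (Fin n))⟫ * c x)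
      (F v) δ C hδ (hbc v 0 h00) ((by fun_prop : Continuous fun x : X =>
        ⟪(v : EuclideanSpace ℝ (Fin n)), (x : EuclideanSpace ℝ (Fin n))⟫).mul hc)
      (hbLip v) ?_ (fun t ht => (hF v t ht).1) (fun t ht => (hF v t ht).2) x0 hx0 huniq
    · have hD2 := (hD.inv (hFpos v 0 h00).ne').tendsto_slope_zero
      have hval : -(⟪(v : EuclideanSpace ℝ (Fin n)), (x0 : EuclideanSpace ℝ (Fin n))⟫ * c x0) / F v 0 ^ 2
          = f gx ^ q / (q * suppFn K gx ^ q) * radFn K v := by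
        have hFp := hFpos v 0 h00
        have hAx := hA0 x0
        have hcx : c x0 = p * B x0 * (A x0 ^ p / A x0) := by
          simp only [c]; rw [Real.rpow_sub_one hAx.ne']
        have hFb : F v 0 =
            ⟪(v : EuclideanSpace ℝ (Fin n)), (x0 : EuclideanSpace ℝ (Fin n))⟫ * A x0 ^ p := by
          rw [← hx0, hb0, hA0p]
        have : -(⟪(v : EuclideanSpace ℝ (Fin n)), (x0 : EuclideanSpace ℝ (Fin n))⟫ * c x0)
            = (1 / q) * (B x0 / A x0) * F v 0 := by
          rw [hcx, hFb]; simp only [p]; ring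
        rw [this, hrad0]
        change _ = B x0 / (q * A x0) * _
        field_simp
      rw [hval] at hD2
      refine hD2.congr' ?_
      have e2 : ∀ᶠ t : ℝ in 𝓝[≠] 0, |t| < δ := nhdsWithin_le_nhds
        ((continuous_abs).continuousAt.eventually_lt_const (by simpa using hδ))
      filter_upwards [e2] with t ht
      rw [hrad v t ht, hrad0]
      simp only [zero_add, smul_eq_mul, Pi.inv_apply]
      rw [div_eq_inv_mul]
    · intro ε hε
      obtain ⟨δ', hδ', H⟩ := aux_pow A B hA hB hA0 p ε hε
      refine ⟨δ', hδ', fun t ht x => ?_⟩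
      have h1 := (H t ht x).2
      have : b v t x - b v 0 x -
          t * (⟪(v : EuclideanSpace ℝ (Fin n)), (x : EuclideanSpace ℝ (Fin n))⟫ * c x) =
          ⟪(v : EuclideanSpace ℝ (Fin n)), (x : EuclideanSpace ℝ (Fin n))⟫ *
          ((A x + t * B x) ^ p - A x ^ p - t * (p * B x * A x ^ (p - 1))) := by
        simp only [b, c, zero_mul, add_zero]; ring
      rw [this, abs_mul]
      calc _ ≤ 1 * |(A x + t * B x) ^ p - A x ^ p - t * (p * B x * A x ^ (p - 1))| :=
            mul_le_mul_of_nonneg_right (hin v x) (abs_nonneg _)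
        _ ≤ _ := by rw [one_mul]; exact h1
end

section
/- Let K be a convex body with 0 in its interior, f continuous and positive on S^{n-1}, q ≠ 0, and h_t(v) = (h_K(v)^q + t f(v)^q)^{1/q}. Let G : ℝⁿ → [0,∞) be bounded and measurable and define φ_t(v) = ∫_0^{ρ_{[h_t]}(v)} G(ξ v) ξ^{n−1} dξ for v ∈ S^{n-1}. If at v the Gauss map g_K is defined at r_K(v) and G is continuous at r_K(v), then lim_{t→0} (φ_t(v) − φ_0(v))/t = G(r_K(v)) · (f(g_K(r_K(v)))^q / (q h_K(g_K(r_K(v)))^q)) · ρ_K(v)ⁿ. -/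
open scoped RealInnerProductSpace
open MeasureTheory Filter Topology

lemma aux_loc {X : Type*} [TopologicalSpace X] (p : ℝ) (m : X → ℝ) (x0 : X)
    (hm : ContinuousAt m x0) (ε : ℝ) (hε : 0 < ε) :
    ∀ᶠ z : ℝ × X in 𝓝 ((0 : ℝ), x0),
      |(1 + z.1 * m z.2) ^ p - 1 - z.1 * (p * m x0)| ≤ ε * |z.1| := by
  have hd : HasDerivAt (fun s : ℝ => (1 + s) ^ p) p 0 := by
    have h1 : HasDerivAt (fun s : ℝ => 1 + s) 1 0 := by
      simpa using (hasDerivAt_id (0 : ℝ)).const_add 1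
    have := h1.rpow_const (p := p) (Or.inl (by norm_num))
    simpa using this
  have hm2 : ContinuousAt (fun z : ℝ × X => m z.2) ((0 : ℝ), x0) :=
    ContinuousAt.comp (g := m) (f := Prod.snd) (x := ((0 : ℝ), x0)) hm continuousAt_snd
  set M := |m x0| + 1 with hM
  have hMpos : 0 < M := by positivity
  have hc : 0 < ε / (2 * M) := by positivity
  have ho := (hasDerivAt_iff_isLittleO.1 hd).def hc
  have hs : Tendsto (fun z : ℝ × X => z.1 * m z.2) (𝓝 ((0 : ℝ), x0)) (𝓝 0) := by
    have : ContinuousAt (fun z : ℝ × X => z.1 * m z.2) ((0 : ℝ), x0) :=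
      continuousAt_fst.mul hm2
    simpa [ContinuousAt] using this
  have h1 := hs.eventually ho
  have h2 : ∀ᶠ z : ℝ × X in 𝓝 ((0 : ℝ), x0), |m z.2| < M :=
    hm2.abs.eventually_lt_const (by simp [hM])
  have h3 : ∀ᶠ z : ℝ × X in 𝓝 ((0 : ℝ), x0), |p * m z.2 - p * m x0| < ε / 2 := by
    have : ContinuousAt (fun z : ℝ × X => |p * m z.2 - p * m x0|) ((0 : ℝ), x0) :=
      ((continuousAt_const.mul hm2).sub continuousAt_const).abs
    exact this.eventually_lt_const (by simpa using hε)
  filter_upwards [h1, h2, h3] with z h1 h2 h3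
  simp only [Real.norm_eq_abs, add_zero, Real.one_rpow, sub_zero, smul_eq_mul] at h1
  have e : (1 + z.1 * m z.2) ^ p - 1 - z.1 * (p * m x0)
      = ((1 + z.1 * m z.2) ^ p - 1 - z.1 * m z.2 * p) + z.1 * (p * m z.2 - p * m x0) := by ring
  rw [e]
  have a1 : ε / (2 * M) * |z.1 * m z.2| ≤ ε / 2 * |z.1| := by
    rw [abs_mul]
    have : ε / (2 * M) * (|z.1| * |m z.2|) ≤ ε / (2 * M) * (|z.1| * M) := by gcongr
    refine this.trans (le_of_eq ?_)
    field_simp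
  have a2 : |z.1 * (p * m z.2 - p * m x0)| ≤ ε / 2 * |z.1| := by
    rw [abs_mul, mul_comm]; gcongr
  calc _ ≤ _ := abs_add_le _ _
    _ ≤ ε / 2 * |z.1| + ε / 2 * |z.1| := add_le_add (h1.trans a1) a2
    _ = _ := by ring

section
variable {n : ℕ} {K : Set (EuclideanSpace ℝ (Fin n))}

lemma supp_cont (hK : IsCompact K) : Continuous (suppFn K) := by
  have : Continuous (fun w : EuclideanSpace ℝ (Fin n) =>
      sSup ((fun (w x : EuclideanSpace ℝ (Fin n)) => ⟪x, w⟫) w '' K)) := by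
    apply IsCompact.continuous_sSup hK
    change Continuous (fun z : EuclideanSpace ℝ (Fin n) × EuclideanSpace ℝ (Fin n) => ⟪z.2, z.1⟫)
    fun_prop
  exact this

lemma le_supp (hK : IsCompact K) {x : EuclideanSpace ℝ (Fin n)} (hx : x ∈ K)
    (w : EuclideanSpace ℝ (Fin n)) : ⟪x, w⟫ ≤ suppFn K w := by
  apply le_csSup
  · exact (hK.image (by fun_prop)).bddAbove
  · exact ⟨x, hx, rfl⟩

lemma exists_small (h0K : (0 : EuclideanSpace ℝ (Fin n)) ∈ interior K) :
    ∃ r : ℝ, 0 < r ∧ ∀ u : EuclideanSpace ℝ (Fin n), ‖u‖ = 1 → r • u ∈ K := by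
  obtain ⟨ε, hε, h⟩ := Metric.mem_nhds_iff.1 (mem_interior_iff_mem_nhds.1 h0K)
  refine ⟨ε / 2, by positivity, fun u hu => h ?_⟩
  rw [mem_ball_zero_iff, norm_smul, hu, Real.norm_of_nonneg (by positivity)]
  linarith

lemma supp_pos (hK : IsCompact K) (h0K : (0 : EuclideanSpace ℝ (Fin n)) ∈ interior K)
    {u : EuclideanSpace ℝ (Fin n)} (hu : ‖u‖ = 1) : 0 < suppFn K u := by
  obtain ⟨r, hr, h⟩ := exists_small h0K
  refine lt_of_lt_of_le ?_ (le_supp hK (h u hu) u)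
  rw [real_inner_smul_left, real_inner_self_eq_norm_sq, hu]
  linarith

lemma rad_bdd (hK : IsCompact K) {v : EuclideanSpace ℝ (Fin n)} (hv : ‖v‖ = 1) :
    BddAbove {c : ℝ | 0 ≤ c ∧ c • v ∈ K} := by
  refine ⟨suppFn K v, fun c hc => ?_⟩
  have := le_supp hK hc.2 v
  rwa [real_inner_smul_left, real_inner_self_eq_norm_sq, hv, one_pow, mul_one] at this

lemma rad_pos (hK : IsCompact K) (h0K : (0 : EuclideanSpace ℝ (Fin n)) ∈ interior K)
    {v : EuclideanSpace ℝ (Fin n)} (hv : ‖v‖ = 1) : 0 < radFn K v := by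
  obtain ⟨r, hr, h⟩ := exists_small h0K
  exact lt_of_lt_of_le hr (le_csSup (rad_bdd hK hv) ⟨hr.le, h v hv⟩)

lemma rad_mem (hK : IsCompact K) (h0K : (0 : EuclideanSpace ℝ (Fin n)) ∈ interior K)
    {v : EuclideanSpace ℝ (Fin n)} (hv : ‖v‖ = 1) : radFn K v • v ∈ K := by
  have hc : IsClosed {c : ℝ | 0 ≤ c ∧ c • v ∈ K} := by
    have h1 : IsClosed {c : ℝ | c • v ∈ K} :=
      hK.isClosed.preimage (f := fun c : ℝ => c • v) (by fun_prop)
    exact isClosed_Ici.inter h1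
  obtain ⟨r, hr, h⟩ := exists_small h0K
  exact (hc.csSup_mem ⟨r, hr.le, h v hv⟩ (rad_bdd hK hv)).2

lemma ratio_eq {q a b t : ℝ} (hq : q ≠ 0) (ha : 0 < a) (hp : 0 ≤ 1 + t * (b / a ^ q)) :
    (a ^ q + t * b) ^ (1 / q) = a * (1 + t * (b / a ^ q)) ^ (1 / q) := by
  have h1 : 0 < a ^ q := Real.rpow_pos_of_pos ha q
  have e : a ^ q + t * b = a ^ q * (1 + t * (b / a ^ q)) := by field_simp
  rw [e, Real.mul_rpow h1.le hp, ← Real.rpow_mul ha.le, mul_one_div_cancel hq, Real.rpow_one]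

lemma rad_deriv (q : ℝ) (hq : q ≠ 0) (hK : IsCompact K)
    (h0K : (0 : EuclideanSpace ℝ (Fin n)) ∈ interior K)
    (f : EuclideanSpace ℝ (Fin n) → ℝ) (hf : Continuous f)
    (hfpos : ∀ w : EuclideanSpace ℝ (Fin n), ‖w‖ = 1 → 0 < f w)
    (v : EuclideanSpace ℝ (Fin n)) (hv : ‖v‖ = 1) (w0 : EuclideanSpace ℝ (Fin n))
    (hw1 : ‖w0‖ = 1) (hw2 : ∀ y ∈ K, ⟪y, w0⟫ ≤ ⟪radFn K v • v, w0⟫)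
    (hw3 : ∀ w : EuclideanSpace ℝ (Fin n), ‖w‖ = 1 →
        (∀ y ∈ K, ⟪y, w⟫ ≤ ⟪radFn K v • v, w⟫) → w = w0) :
    radFn (wulff fun u => (suppFn K u ^ q + 0 * f u ^ q) ^ (1 / q)) v = radFn K v ∧
    HasDerivAt (fun t : ℝ => radFn (wulff fun u => (suppFn K u ^ q + t * f u ^ q) ^ (1 / q)) v)
      (radFn K v * (1 / q * (f w0 ^ q / suppFn K w0 ^ q))) 0 := by
  have hρ := rad_pos hK h0K hv
  have hmem := rad_mem hK h0K hv
  have hsc := supp_cont hK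
  have hsp : ∀ u : EuclideanSpace ℝ (Fin n), ‖u‖ = 1 → 0 < suppFn K u :=
    fun u hu => supp_pos hK h0K hu
  set ρ := radFn K v
  set h := suppFn K
  have hle : ∀ u, ρ * ⟪v, u⟫ ≤ h u := fun u => by
    rw [← real_inner_smul_left]; exact le_supp hK hmem u
  have hKne : K.Nonempty := ⟨_, hmem⟩
  have heq : h w0 = ρ * ⟪v, w0⟫ := by
    refine le_antisymm ?_ (hle w0)
    rw [← real_inner_smul_left]
    apply csSup_le (hKne.image _)
    rintro _ ⟨y, hy, rfl⟩
    exact hw2 y hy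
  have hlt : ∀ u : EuclideanSpace ℝ (Fin n), ‖u‖ = 1 → u ≠ w0 → ρ * ⟪v, u⟫ < h u := by
    intro u hu hne
    refine lt_of_le_of_ne (hle u) fun he => hne (hw3 u hu fun y hy => ?_)
    rw [real_inner_smul_left, he]
    exact le_supp hK hy u
  set m : EuclideanSpace ℝ (Fin n) → ℝ := fun u => f u ^ q / h u ^ q with hm
  have hmc : ∀ u : EuclideanSpace ℝ (Fin n), ‖u‖ = 1 → ContinuousAt m u := by
    intro u hu
    refine ContinuousAt.div ?_ ?_ (Real.rpow_pos_of_pos (hsp u hu) q).ne'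
    · exact hf.continuousAt.rpow_const (Or.inl (hfpos u hu).ne')
    · exact hsc.continuousAt.rpow_const (Or.inl (hsp u hu).ne')
  have hsm : ∀ u : EuclideanSpace ℝ (Fin n), ‖u‖ = 1 →
      ∀ᶠ z : ℝ × EuclideanSpace ℝ (Fin n) in 𝓝 ((0 : ℝ), u), 0 < 1 + z.1 * m z.2 := by
    intro u hu
    have hm2 : ContinuousAt (fun z : ℝ × EuclideanSpace ℝ (Fin n) => m z.2) ((0 : ℝ), u) :=
      ContinuousAt.comp (g := m) (f := Prod.snd) (x := ((0 : ℝ), u)) (hmc u hu) continuousAt_snd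
    have : ContinuousAt (fun z : ℝ × EuclideanSpace ℝ (Fin n) => 1 + z.1 * m z.2) ((0 : ℝ), u) :=
      continuousAt_const.add (continuousAt_fst.mul hm2)
    exact this.eventually_const_lt (by simp)
  have hvw : 0 < ⟪v, w0⟫ := by
    have := hsp w0 hw1
    rw [heq] at this
    exact pos_of_mul_pos_right this hρ.le
  set L := 1 / q * m w0 with hL
  change _ ∧ HasDerivAt _ (ρ * L) 0
  set R : ℝ → ℝ := fun t => radFn (wulff fun u => (h u ^ q + t * f u ^ q) ^ (1 / q)) v with hR
  have key : ∀ ε : ℝ, 0 < ε → ∀ᶠ t in 𝓝 (0 : ℝ), |R t - ρ - t * (ρ * L)| ≤ ε * |t| := by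
    intro ε hε
    have hε' : 0 < ε / ρ := by positivity
    have loc := aux_loc (1 / q) m w0 (hmc w0 hw1) (ε / ρ) hε'
    have hcpos : ∀ᶠ t in 𝓝 (0 : ℝ), 0 < 1 + t * L - ε / ρ * |t| := by
      have : ContinuousAt (fun t : ℝ => 1 + t * L - ε / ρ * |t|) 0 := by fun_prop
      exact this.eventually_const_lt (by simp)
    have low : ∀ᶠ t in 𝓝 (0 : ℝ), ∀ u ∈ Metric.sphere (0 : EuclideanSpace ℝ (Fin n)) 1,
        ρ * (1 + t * L - ε / ρ * |t|) * ⟪v, u⟫ ≤ (h u ^ q + t * f u ^ q) ^ (1 / q) := by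
      apply (isCompact_sphere (0 : EuclideanSpace ℝ (Fin n)) 1).eventually_forall_of_forall_eventually
      intro u hu
      have hu1 : ‖u‖ = 1 := by simpa using hu
      by_cases huw : u = w0
      · subst huw
        have e3 : ∀ᶠ z : ℝ × EuclideanSpace ℝ (Fin n) in 𝓝 ((0 : ℝ), u),
            0 < 1 + z.1 * L - ε / ρ * |z.1| :=
          (continuousAt_fst (p := ((0 : ℝ), u))).eventually hcpos
        have e4 : ∀ᶠ z : ℝ × EuclideanSpace ℝ (Fin n) in 𝓝 ((0 : ℝ), u), 0 < h z.2 :=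
          (hsc.comp continuous_snd).continuousAt.eventually_const_lt (hsp u hu1)
        filter_upwards [loc, hsm u hu1, e3, e4] with z h1 h2 h3 h4
        rw [ratio_eq hq h4 h2.le]
        have h5 := (abs_le.1 h1).1
        calc ρ * (1 + z.1 * L - ε / ρ * |z.1|) * ⟪v, z.2⟫
            = (ρ * ⟪v, z.2⟫) * (1 + z.1 * L - ε / ρ * |z.1|) := by ring
          _ ≤ h z.2 * (1 + z.1 * L - ε / ρ * |z.1|) := by
              gcongr; exact hle _
          _ ≤ _ := by
              apply mul_le_mul_of_nonneg_left _ h4.le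
              have : (1 + z.1 * (f z.2 ^ q / h z.2 ^ q)) ^ (1 / q)
                = (1 + z.1 * m z.2) ^ (1 / q) := rfl
              rw [this]
              linarith
      · have c1 : ContinuousAt (fun z : ℝ × EuclideanSpace ℝ (Fin n) =>
            ρ * (1 + z.1 * L - ε / ρ * |z.1|) * ⟪v, z.2⟫) ((0 : ℝ), u) := by fun_prop
        have c2 : ContinuousAt (fun z : ℝ × EuclideanSpace ℝ (Fin n) =>
            (h z.2 ^ q + z.1 * f z.2 ^ q) ^ (1 / q)) ((0 : ℝ), u) := by
          refine ContinuousAt.rpow_const (ContinuousAt.add ?_ (ContinuousAt.mul ?_ ?_)) ?_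
          · exact (hsc.comp continuous_snd).continuousAt.rpow_const (Or.inl (hsp u hu1).ne')
          · exact continuousAt_fst
          · exact (hf.comp continuous_snd).continuousAt.rpow_const (Or.inl (hfpos u hu1).ne')
          · left
            simpa using (Real.rpow_pos_of_pos (hsp u hu1) q).ne'
        refine (c1.eventually_lt c2 ?_).mono fun z hz => hz.le
        simp only [zero_mul, add_zero, abs_zero, mul_zero, sub_zero, mul_one]
        rw [← Real.rpow_mul (hsp u hu1).le, mul_one_div_cancel hq, Real.rpow_one]
        exact hlt u hu1 huw
    have ct : Tendsto (fun t : ℝ => (t, w0)) (𝓝 0) (𝓝 ((0 : ℝ), w0)) := by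
      have : Continuous (fun t : ℝ => (t, w0)) := by fun_prop
      exact this.tendsto 0
    filter_upwards [low, hcpos, ct.eventually loc, ct.eventually (hsm w0 hw1)] with t h1 h2 h3 h4
    have hup : ∀ c ∈ {c : ℝ | 0 ≤ c ∧ c • v ∈ wulff fun u => (h u ^ q + t * f u ^ q) ^ (1 / q)},
        c ≤ ρ * (1 + t * m w0) ^ (1 / q) := by
      rintro c ⟨hc0, hc⟩
      have := hc w0 hw1
      beta_reduce at this
      rw [ratio_eq hq (hsp w0 hw1) h4.le, real_inner_smul_left] at this
      have e : h w0 * (1 + t * m w0) ^ (1 / q) = ρ * ⟪v, w0⟫ * (1 + t * m w0) ^ (1 / q) :=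
        congrArg (fun y => y * (1 + t * m w0) ^ (1 / q)) heq
      replace this := this.trans_eq e
      refine le_of_mul_le_mul_right (this.trans_eq ?_) hvw
      ring
    have hRup : R t ≤ ρ * (1 + t * m w0) ^ (1 / q) :=
      Real.sSup_le hup (mul_nonneg hρ.le (Real.rpow_nonneg h4.le _))
    have hRlow : ρ * (1 + t * L - ε / ρ * |t|) ≤ R t := by
      refine le_csSup ⟨_, hup⟩ ⟨by positivity, fun u hu => ?_⟩
      rw [real_inner_smul_left]
      exact h1 u (by simpa using hu)
    have e1 : ρ * (1 + t * L - ε / ρ * |t|) = ρ + t * (ρ * L) - ε * |t| := by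
      field_simp
    have h5 := (abs_le.1 h3).2
    have e2 : ρ * (1 + t * m w0) ^ (1 / q) ≤ ρ + t * (ρ * L) + ε * |t| := by
      have : (1 + t * m w0) ^ (1 / q) ≤ 1 + t * L + ε / ρ * |t| := by linarith
      calc _ ≤ ρ * (1 + t * L + ε / ρ * |t|) := by gcongr
        _ = _ := by field_simp
    rw [abs_le]
    constructor <;> linarith
  have hR0 : R 0 = ρ := by
    have := (key 1 one_pos).self_of_nhds
    simp only [zero_mul, abs_zero, mul_zero, sub_zero] at this
    linarith [abs_nonpos_iff.1 this]
  refine ⟨hR0, ?_⟩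
  rw [hasDerivAt_iff_isLittleO, Asymptotics.isLittleO_iff]
  intro c hc
  filter_upwards [key c hc] with t ht
  rw [hR0]
  simpa using ht
end

/-- Differentiation of `φ_t(v) = ∫_0^{ρ_{[h_t]}(v)} G(ξv) ξ^{n-1} dξ` at `t = 0`:
if the Gauss map of `K` is (uniquely) defined at `r_K(v)` and `G` is continuous there,
then `(φ_t(v) − φ_0(v))/t → G(r_K(v)) · (f^q/(q h_K^q))(g_K(r_K(v))) · ρ_K(v)ⁿ`. -/
theorem stmt18 {n : ℕ} (hn : 2 ≤ n) (q : ℝ) (hq : q ≠ 0)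
    (K : Set (EuclideanSpace ℝ (Fin n)))
    (hKconv : Convex ℝ K) (hKcomp : IsCompact K)
    (h0K : (0 : EuclideanSpace ℝ (Fin n)) ∈ interior K)
    (f : EuclideanSpace ℝ (Fin n) → ℝ) (hf : Continuous f)
    (hfpos : ∀ w : EuclideanSpace ℝ (Fin n), ‖w‖ = 1 → 0 < f w)
    (G : EuclideanSpace ℝ (Fin n) → ℝ) (hGmeas : Measurable G) (hGnonneg : ∀ x, 0 ≤ G x)
    (hGbdd : ∃ B : ℝ, ∀ x, G x ≤ B)
    (v : EuclideanSpace ℝ (Fin n)) (hv : ‖v‖ = 1)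
    (g : EuclideanSpace ℝ (Fin n) → EuclideanSpace ℝ (Fin n))
    -- `g(r_K(v))` is the unique outer unit normal of `K` at `r_K(v)`
    (hg : ‖g (radFn K v • v)‖ = 1 ∧
      (∀ y ∈ K, ⟪y, g (radFn K v • v)⟫ ≤ ⟪radFn K v • v, g (radFn K v • v)⟫) ∧
      ∀ w : EuclideanSpace ℝ (Fin n), ‖w‖ = 1 →
        (∀ y ∈ K, ⟪y, w⟫ ≤ ⟪radFn K v • v, w⟫) → w = g (radFn K v • v))
    (hGcont : ContinuousAt G (radFn K v • v)) :
    Tendsto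
      (fun t : ℝ =>
        ((∫ s in (0 : ℝ)..(radFn
              (wulff fun u => (suppFn K u ^ q + t * f u ^ q) ^ (1 / q)) v),
            G (s • v) * s ^ (n - 1)) -
          ∫ s in (0 : ℝ)..(radFn K v), G (s • v) * s ^ (n - 1)) / t)
      (𝓝[≠] 0)
      (𝓝 (G (radFn K v • v) *
        (f (g (radFn K v • v)) ^ q / (q * suppFn K (g (radFn K v • v)) ^ q)) *
        radFn K v ^ n)) := by
  obtain ⟨hg1, hg2, hg3⟩ := hg
  obtain ⟨hR0, hRd⟩ := rad_deriv q hq hKcomp h0K f hf hfpos v hv _ hg1 hg2 hg3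
  obtain ⟨B, hB⟩ := hGbdd
  set ρ := radFn K v with hρ
  set w0 := g (ρ • v)
  have hmeas : Measurable (fun s : ℝ => G (s • v) * s ^ (n - 1)) := by
    have : Measurable (fun s : ℝ => s • v) := by fun_prop
    exact (hGmeas.comp this).mul (by fun_prop)
  have hint : IntervalIntegrable (fun s : ℝ => G (s • v) * s ^ (n - 1)) volume 0 ρ := by
    have hc : Continuous (fun s : ℝ => B * |s ^ (n - 1)|) := by fun_prop
    refine (hc.intervalIntegrable 0 ρ).mono_fun' hmeas.aestronglyMeasurable ?_
    refine Eventually.of_forall fun s => ?_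
    simp only [norm_mul, Real.norm_eq_abs, abs_of_nonneg (hGnonneg _)]
    gcongr
    exact hB _
  have hcont : ContinuousAt (fun s : ℝ => G (s • v) * s ^ (n - 1)) ρ := by
    have h1 : ContinuousAt (fun s : ℝ => s • v) ρ := by fun_prop
    exact (ContinuousAt.comp (g := G) (f := fun s : ℝ => s • v) hGcont h1).mul (by fun_prop)
  have hφ := intervalIntegral.integral_hasDerivAt_right hint
    (hmeas.stronglyMeasurable.stronglyMeasurableAtFilter) hcont
  rw [← hR0] at hφ
  have hcomp := HasDerivAt.comp (0 : ℝ) hφ hRd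
  have hs := hasDerivAt_iff_tendsto_slope.1 hcomp
  have hval : G (ρ • v) * (f w0 ^ q / (q * suppFn K w0 ^ q)) * ρ ^ n
      = G (ρ • v) * ρ ^ (n - 1) * (ρ * (1 / q * (f w0 ^ q / suppFn K w0 ^ q))) := by
    obtain ⟨k, rfl⟩ : ∃ k, n = k + 1 := ⟨n - 1, by omega⟩
    rw [Nat.add_sub_cancel, pow_succ]
    have : f w0 ^ q / (q * suppFn K w0 ^ q) = 1 / q * (f w0 ^ q / suppFn K w0 ^ q) := by
      rw [div_mul_div_comm, one_mul]
    rw [this]; ring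
  rw [hval]
  rw [hR0] at hs
  refine hs.congr fun t => ?_
  rw [slope_def_field, Function.comp_apply, Function.comp_apply, hR0, sub_zero]
end
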